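/- arXiv:2210.10185 — 2 statements merged into one kernel-verified Lean document; each statement's English description precedes it below -/
import Mathlib

section
/- Let γ₁, γ₂, μ ∈ ℝ with |1 − μγ₂| < 1, and let A_g be the 2×2 real matrix [[0, γ₁], [0, 1 − μγ₂]]. Then for every ε ∈ ℝ², the iterates A_g^m · ε converge to the zero vector as m → ∞. In particular, under repeated synchronization cycles of the adaptive sender–receiver algorithm, both the clock error and the clock-rate error converge to zero. -/
open Matrix Filter

theorem pow_succ_of_mul_self_eq_smul {R M : Type*} [CommSemiring R] [Semiring M] [Algebra R M]
    {a : M} {r : R} (h : a * a = r • a) (m : ℕ) : a ^ (m + 1) = r ^ m • a := by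
  induction m with
  | zero => simp
  | succ k ih => rw [pow_succ, ih, smul_mul_assoc, h, smul_smul, pow_succ]

/-- If `|1 − μγ₂| < 1`, then the iterates `A_g^m · ε` converge to zero for every
initial error `ε`: clock error and clock-rate error converge to zero under repeated
synchronization cycles. -/
theorem sync_iterates_tendsto_zero
    (γ₁ γ₂ μ : ℝ) (hcontr : |1 - μ * γ₂| < 1)
    (A_g : Matrix (Fin 2) (Fin 2) ℝ)
    (hAg : A_g = !![0, γ₁; 0, 1 - μ * γ₂]) :
    ∀ ε : Fin 2 → ℝ,
      Tendsto (fun m : ℕ => (A_g ^ m).mulVec ε) atTop (nhds 0) := by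
  intro ε
  have hsq : A_g * A_g = (1 - μ * γ₂) • A_g := by
    subst hAg
    ext i j
    fin_cases i <;> fin_cases j <;> simp [mul_comm]
  rw [← tendsto_add_atTop_iff_nat 1]
  simp only [pow_succ_of_mul_self_eq_smul hsq, smul_mulVec]
  simpa using (tendsto_pow_atTop_nhds_zero_of_abs_lt_one hcontr).smul_const (A_g *ᵥ ε)
end

section
/- Let 0 < c ≤ d, let P = [[p₁₁, p₁₂], [p₁₂, p₂₂]] be a symmetric positive definite 2×2 real matrix, let p ∈ {0, 1, 2, 3, 4, 5}, let e > 0, and set α = 2(c − d)/c, β = 6d·p₁₁ − p₁₂, and γ = |α|·max{p₁₁·e/2, β + p₁₁/(2e)}. For (ε_τ, ε_a) ∈ ℝ² and τ ∈ [0, c], define r(τ) = τ·(d/c) + d·(5 − p) and W(ε_τ, ε_a, τ) = p₁₁·(ε_τ + ε_a·r(τ))² + 2p₁₂·ε_a·(ε_τ + ε_a·r(τ)) + p₂₂·ε_a². Then the derivative of W along the flow direction (ε̇_τ, ε̇_a, τ̇) = (ε_a, 0, −1), namely (d/ds)|_{s=0} W(ε_τ + s·ε_a, ε_a, τ − s),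 is at most γ·(ε_τ² + ε_a²) for all τ ∈ [0, c] and all (ε_τ, ε_a) ∈ ℝ². -/
open Matrix

/-- During residence phases, the derivative of the Lyapunov quadratic form `W` along the
flow direction `(ε̇_τ, ε̇_a, τ̇) = (ε_a, 0, −1)` is bounded by `γ·(ε_τ² + ε_a²)`. -/
theorem lyapunov_flow_bound_residence
    (c d : ℝ) (hc : 0 < c) (hcd : c ≤ d)
    (p11 p12 p22 : ℝ)
    (P : Matrix (Fin 2) (Fin 2) ℝ) (hPdef : P = !![p11, p12; p12, p22]) (hPpos : P.PosDef)
    (p : ℕ) (hp : p ≤ 5) (e : ℝ) (he : 0 < e)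
    (α β γ : ℝ)
    (hα : α = 2 * (c - d) / c)
    (hβ : β = 6 * d * p11 - p12)
    (hγ : γ = |α| * max (p11 * e / 2) (β + p11 / (2 * e)))
    (r : ℝ → ℝ) (hr : ∀ τ, r τ = τ * (d / c) + d * (5 - (p : ℝ)))
    (W : ℝ → ℝ → ℝ → ℝ)
    (hW : ∀ ετ εa τ, W ετ εa τ =
      p11 * (ετ + εa * r τ) ^ 2 + 2 * p12 * εa * (ετ + εa * r τ) + p22 * εa ^ 2) :
    ∀ ετ εa : ℝ, ∀ τ ∈ Set.Icc (0 : ℝ) c,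
      deriv (fun s => W (ετ + s * εa) εa (τ - s)) 0 ≤ γ * (ετ ^ 2 + εa ^ 2) := by
  intro x y τ hτ
  have hp11 : 0 < p11 := by
    have h := hPpos.diag_pos (i := 0)
    simpa [hPdef] using h
  have hd : 0 < d := hc.trans_le hcd
  have hp5 : (p : ℝ) ≤ 5 := by exact_mod_cast hp
  have hr0 : 0 ≤ r τ := by
    rw [hr]
    exact add_nonneg (mul_nonneg hτ.1 (by positivity)) (mul_nonneg hd.le (by linarith))
  have hα_slope : 1 - d / c = α / 2 := by
    rw [hα]
    field_simp
  have hα_nonpos : α ≤ 0 := by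
    rw [hα]
    exact div_nonpos_of_nonpos_of_nonneg (by linarith) hc.le
  have hflow : (fun s => W (x + s * y) y (τ - s)) = fun s =>
      p11 * (x + y * r τ + y * (α / 2) * s) ^ 2
        + 2 * p12 * y * (x + y * r τ + y * (α / 2) * s) + p22 * y ^ 2 := by
    funext s
    rw [hW, hr, hr, ← hα_slope]
    ring
  have hlin : HasDerivAt (fun s : ℝ => x + y * r τ + y * (α / 2) * s) (y * (α / 2)) 0 := by
    simpa using ((hasDerivAt_id (0 : ℝ)).const_mul (y * (α / 2))).const_add (x + y * r τ)
  have hderiv : deriv (fun s => W (x + s * y) y (τ - s)) 0 =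
      -α * (-(p11 * x * y) - (p11 * r τ + p12) * y ^ 2) := by
    rw [hflow]
    refine ((((hlin.pow 2).const_mul p11).add
      (hlin.const_mul (2 * p12 * y))).add_const (p22 * y ^ 2)).deriv.trans ?_
    norm_num
    ring
  rw [hderiv, hγ, abs_of_nonpos hα_nonpos, mul_assoc (-α)]
  refine mul_le_mul_of_nonneg_left ?_ (neg_nonneg.mpr hα_nonpos)
  have hyoung : -(p11 * x * y) ≤ p11 * e / 2 * x ^ 2 + p11 / (2 * e) * y ^ 2 := by
    have hsq : p11 * e / 2 * x ^ 2 + p11 / (2 * e) * y ^ 2 + p11 * x * y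
        = p11 / (2 * e) * (e * x + y) ^ 2 := by
      field_simp
      ring
    have hnonneg : 0 ≤ p11 / (2 * e) * (e * x + y) ^ 2 := by positivity
    linarith
  have hcoeff : -(p11 * r τ + p12) * y ^ 2 ≤ β * y ^ 2 := by
    refine mul_le_mul_of_nonneg_right ?_ (sq_nonneg y)
    rw [hβ]
    have := mul_nonneg hp11.le hr0
    have := mul_pos hd hp11
    linarith
  have hmax_left := mul_le_mul_of_nonneg_right
    (le_max_left (p11 * e / 2) (β + p11 / (2 * e))) (sq_nonneg x)
  have hmax_right := mul_le_mul_of_nonneg_right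
    (le_max_right (p11 * e / 2) (β + p11 / (2 * e))) (sq_nonneg y)
  linarith
end
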